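/- Let σ be a substitution on the alphabet A = {1,…,d} with incidence matrix M, and let u be a fixed point of σ beginning with a letter a such that the lengths |σ^k(a)| tend to infinity. Suppose π : ℝ^d → ℝ^{d-1} is a surjective linear map for which there exist a linear map N : ℝ^{d-1} → ℝ^{d-1} with π ∘ M = N ∘ π, and constants C ≥ 0 and 0 ≤ ρ < 1 such that ‖N^n x‖ ≤ C·ρ^n·‖x‖ for all n ∈ ℕ and all x ∈ ℝ^{d-1}. Then the projected canonical stepped line {π(l(p)) : p a finite prefix of u} is a bounded subset of ℝ^{d-1}; in particular its closure, the Rauzy fractal of σ, is compact. -/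

import Mathlib

/- STATEMENT 5: If the projection π intertwines the incidence matrix M with a
linear map N which is contracting, then the projected canonical stepped line of
a fixed point is bounded; in particular its closure (the Rauzy fractal) is
compact. -/

namespace Stmt5

/-- Extension of a substitution (letter → word) to finite words. -/
def subst {d : ℕ} (σ : Fin d → List (Fin d)) (w : List (Fin d)) : List (Fin d) :=
  w.flatMap σ

/-- Abelianization of a finite word, viewed in ℝ^d. -/
def abel {d : ℕ} (w : List (Fin d)) : Fin d → ℝ :=
  fun i => (w.count i : ℝ)

/-- `w` is a (finite) prefix of the infinite word `u`. -/
def IsPrefixOf {d : ℕ} (w : List (Fin d)) (u : ℕ → Fin d) : Prop :=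
  (List.range w.length).map u = w

/-- `u` is a fixed point of `σ` beginning with the letter `x`. -/
def IsFixedPointOf {d : ℕ} (σ : Fin d → List (Fin d)) (x : Fin d) (u : ℕ → Fin d) : Prop :=
  ∀ k : ℕ, IsPrefixOf ((subst σ)^[k] [x]) u

/-- The incidence matrix of a substitution, with real entries. -/
def incidence {d : ℕ} (σ : Fin d → List (Fin d)) : Matrix (Fin d) (Fin d) ℝ :=
  fun i j => ((σ j).count i : ℝ)

/-- A prefix of a concatenation of blocks is a concatenation of full blocks followed by a prefix of
the next block. -/
theorem exists_eq_flatMap_append_of_prefix {α β : Type*} (f : α → List β) {l : List α}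
    {p : List β} (h : p <+: l.flatMap f) :
    p = [] ∨ ∃ q c r, q <+: l ∧ r <+: f c ∧ p = q.flatMap f ++ r := by
  induction l generalizing p with
  | nil => simp_all
  | cons b t ih =>
    rw [List.flatMap_cons] at h
    right
    rcases List.prefix_or_prefix_of_prefix h (List.prefix_append _ _) with hp | ⟨s, rfl⟩
    · exact ⟨[], b, p, List.nil_prefix, hp, rfl⟩
    · have hs := (List.prefix_append_right_inj _).1 h
      rcases ih hs with rfl | ⟨q, c, r, hq, hr, rfl⟩
      · exact ⟨[], b, f b, List.nil_prefix, List.prefix_rfl, by simp⟩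
      · exact ⟨b :: q, c, r, (List.cons_prefix_cons).2 ⟨rfl, hq⟩, hr, by simp⟩

theorem iterate_subst_eq_flatMap {d : ℕ} (σ : Fin d → List (Fin d)) (k : ℕ) (w : List (Fin d)) :
    (subst σ)^[k] w = w.flatMap fun c => (subst σ)^[k] [c] := by
  induction k generalizing w with
  | zero => simp
  | succ k ih =>
    simp only [Function.iterate_succ_apply]
    rw [ih (subst σ w)]
    conv_rhs => enter [1, c]; rw [ih]
    simp [subst, List.flatMap_assoc]

theorem abel_nil {d : ℕ} : abel ([] : List (Fin d)) = 0 := by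
  ext i
  simp [abel]

theorem abel_append {d : ℕ} (v w : List (Fin d)) : abel (v ++ w) = abel v + abel w := by
  ext i
  simp [abel]

theorem abel_singleton {d : ℕ} (b : Fin d) : abel [b] = Pi.single b 1 := by
  ext i
  simp [abel, List.count_singleton, Pi.single_apply, eq_comm (a := i)]

theorem abel_subst {d : ℕ} (σ : Fin d → List (Fin d)) (w : List (Fin d)) :
    abel (subst σ w) = (incidence σ).mulVec (abel w) := by
  induction w with
  | nil => simp [subst, abel_nil]
  | cons b t ih =>
    rw [← List.singleton_append, abel_append, Matrix.mulVec_add, ← ih, abel_singleton,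
      Matrix.mulVec_single_one, subst, List.flatMap_append, abel_append]
    congr 1
    ext i
    simp [abel, incidence]

theorem map_abel_iterate_subst {d : ℕ} {E : Type*} [AddCommGroup E] [Module ℝ E]
    (σ : Fin d → List (Fin d)) (π : (Fin d → ℝ) →ₗ[ℝ] E) (N : E →ₗ[ℝ] E)
    (hcomm : ∀ x : Fin d → ℝ, π ((incidence σ).mulVec x) = N (π x)) (k : ℕ) (w : List (Fin d)) :
    π (abel ((subst σ)^[k] w)) = (N ^ k) (π (abel w)) := by
  induction k with
  | zero => simp
  | succ k ih => rw [Function.iterate_succ_apply', abel_subst, hcomm, ih, pow_succ']; rfl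

/-- The projected abelianizations of the prefixes of the words `σ^k(b)` are uniformly bounded. -/
theorem exists_bound_of_prefix_iterate_subst {d : ℕ} {E : Type*} [NormedAddCommGroup E]
    [NormedSpace ℝ E] (σ : Fin d → List (Fin d)) (π : (Fin d → ℝ) →ₗ[ℝ] E) (N : E →ₗ[ℝ] E)
    (hcomm : ∀ x : Fin d → ℝ, π ((incidence σ).mulVec x) = N (π x))
    (C ρ : ℝ) (hC : 0 ≤ C) (hρ0 : 0 ≤ ρ) (hρ1 : ρ < 1)
    (hcontr : ∀ (n : ℕ) (x : E), ‖(N ^ n) x‖ ≤ C * ρ ^ n * ‖x‖) :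
    ∃ B : ℝ, ∀ (k : ℕ) (b : Fin d) (p : List (Fin d)),
      p <+: (subst σ)^[k] [b] → ‖π (abel p)‖ ≤ B := by
  have hfin (f : Fin d → List (Fin d)) :
      ∃ R : ℝ, ∀ b p, p <+: f b → ‖π (abel p)‖ ≤ R := by
    have h : (⋃ b, {p | p ∈ (f b).inits}).Finite :=
      Set.finite_iUnion fun b => (f b).inits.finite_toSet
    obtain ⟨R, hR⟩ := (h.image fun p => ‖π (abel p)‖).bddAbove
    exact ⟨R, fun b p hp => hR ⟨p, Set.mem_iUnion.2 ⟨b, (List.mem_inits _ _).2 hp⟩, rfl⟩⟩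
  obtain ⟨R, hR⟩ := hfin σ
  obtain ⟨S, hS⟩ := hfin fun b => [b]
  have key (k : ℕ) (b : Fin d) (p : List (Fin d)) (hp : p <+: (subst σ)^[k] [b]) :
      ‖π (abel p)‖ ≤ S + C * R * ∑ i ∈ Finset.range k, ρ ^ i := by
    have hR0 : 0 ≤ R := (norm_nonneg _).trans (hR b [] List.nil_prefix)
    have hS0 : 0 ≤ S := (norm_nonneg _).trans (hS b [] List.nil_prefix)
    induction k generalizing b p with
    | zero => simpa using hS b p hp
    | succ k ih =>
      rw [Function.iterate_succ_apply, iterate_subst_eq_flatMap] at hp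
      rcases exists_eq_flatMap_append_of_prefix _ hp with rfl | ⟨q, c, r, hq, hr, rfl⟩
      · rw [abel_nil, map_zero, norm_zero]
        positivity
      · rw [← iterate_subst_eq_flatMap, abel_append, map_add, map_abel_iterate_subst σ π N hcomm]
        have hqR : ‖π (abel q)‖ ≤ R := hR b q (by simpa [subst] using hq)
        calc ‖(N ^ k) (π (abel q)) + π (abel r)‖
            ≤ C * ρ ^ k * R + (S + C * R * ∑ i ∈ Finset.range k, ρ ^ i) :=
              (norm_add_le _ _).trans (add_le_add ((hcontr k _).trans (by gcongr)) (ih c r hr))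
          _ = S + C * R * ∑ i ∈ Finset.range (k + 1), ρ ^ i := by
              rw [Finset.sum_range_succ]
              ring
  refine ⟨S + C * R * (1 - ρ)⁻¹, fun k b p hp => (key k b p hp).trans ?_⟩
  have hR0 : 0 ≤ R := (norm_nonneg _).trans (hR b [] List.nil_prefix)
  gcongr
  rw [← tsum_geometric_of_lt_one hρ0 hρ1]
  exact (summable_geometric_of_lt_one hρ0 hρ1).sum_le_tsum _ fun i _ => by positivity

theorem stepped_line_projection_bounded
    {d : ℕ} (σ : Fin d → List (Fin d)) (hσ : ∀ j, σ j ≠ [])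
    (a : Fin d) (u : ℕ → Fin d) (hu : IsFixedPointOf σ a u)
    (hlen : Filter.Tendsto (fun k => ((subst σ)^[k] [a]).length) Filter.atTop Filter.atTop)
    (π : (Fin d → ℝ) →ₗ[ℝ] (Fin (d - 1) → ℝ)) (hπ : Function.Surjective π)
    (N : (Fin (d - 1) → ℝ) →ₗ[ℝ] (Fin (d - 1) → ℝ))
    (hcomm : ∀ x : Fin d → ℝ, π ((incidence σ).mulVec x) = N (π x))
    (C ρ : ℝ) (hC : 0 ≤ C) (hρ0 : 0 ≤ ρ) (hρ1 : ρ < 1)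
    (hcontr : ∀ (n : ℕ) (x : Fin (d - 1) → ℝ), ‖(N ^ n) x‖ ≤ C * ρ ^ n * ‖x‖) :
    Bornology.IsBounded (Set.range fun n => π (abel ((List.range n).map u))) ∧
    IsCompact (closure (Set.range fun n => π (abel ((List.range n).map u)))) := by
  suffices h : Bornology.IsBounded (Set.range fun n => π (abel ((List.range n).map u))) from
    ⟨h, h.isCompact_closure⟩
  obtain ⟨B, hB⟩ := exists_bound_of_prefix_iterate_subst σ π N hcomm C ρ hC hρ0 hρ1 hcontr
  refine isBounded_iff_forall_norm_le.2 ⟨B, ?_⟩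
  rintro _ ⟨n, rfl⟩
  obtain ⟨k, hk⟩ := (hlen.eventually_ge_atTop n).exists
  refine hB k a _ ?_
  rw [← hu k]
  refine List.IsPrefix.map u ?_
  rw [List.prefix_iff_eq_take, List.take_range, List.length_range, min_eq_left hk]

end Stmt5
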